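/- arXiv:2011.01489 — 7 statements merged into one kernel-verified Lean document; each statement's English description precedes it below -/
import Mathlib

section
/- Let H=(A,R) be an abstract argumentation framework, S ⊆ A with S ∩ S⁺ = ∅, choice ⊆ A \ (S ∪ S⁺ ∪ S⁻), tabu = A \ (S ∪ S⁺ ∪ choice), and let x ∈ choice be an argument with {x}⁻ ⊆ S⁺ ∪ tabu. If there is a stable extension T ⊇ S such that T \ S ⊆ choice, then x ∈ T. -/
variable {U : Type*}

/-- `T⁺`: the set of arguments attacked by some member of `T`. -/
def plus (R : Set (U × U)) (T : Set U) : Set U := {y | ∃ x ∈ T, (x, y) ∈ R}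

/-- `T⁻`: the set of arguments attacking some member of `T`. -/
def minus (R : Set (U × U)) (T : Set U) : Set U := {y | ∃ x ∈ T, (y, x) ∈ R}

/-- `S` is a stable extension: `S⁺ = A \ S` (here `A` is the whole type). -/
def IsStable (R : Set (U × U)) (S : Set U) : Prop := plus R S = Set.univ \ S

theorem stmt_1 (R : Set (U × U)) (S choice tabu : Set U)
    (hd : S ∩ plus R S = ∅)
    (hc : choice ⊆ Set.univ \ (S ∪ plus R S ∪ minus R S))
    (ht : tabu = Set.univ \ (S ∪ plus R S ∪ choice))
    (x : U) (hx : x ∈ choice) (hxatt : minus R {x} ⊆ plus R S ∪ tabu)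
    (T : Set U) (hT : IsStable R T) (hST : S ⊆ T) (hTc : T \ S ⊆ choice) :
    x ∈ T := by
  by_contra hxT
  have hxp : x ∈ plus R T := by
    rw [hT]
    exact ⟨Set.mem_univ x, hxT⟩
  obtain ⟨y, hyT, hyx⟩ := hxp
  rcases hxatt ⟨x, rfl, hyx⟩ with ⟨z, hzS, hzy⟩ | hy
  · have hyp : y ∈ plus R T := ⟨z, hST hzS, hzy⟩
    rw [hT] at hyp
    exact hyp.2 hyT
  · rw [ht] at hy
    exact hy.2 (.inr (hTc ⟨hyT, fun hyS => hy.2 (.inl (.inl hyS))⟩))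
end

section
/- Let H=(A,R) be an abstract argumentation framework, S ⊆ A with S ∩ S⁺ = ∅, choice ⊆ A \ (S ∪ S⁺ ∪ S⁻), tabu = A \ (S ∪ S⁺ ∪ choice), and let x ∈ choice be an argument such that for some y ∈ tabu it holds that {y}⁻ ∩ choice = {x}. If there is a stable extension T ⊇ S such that T \ S ⊆ choice, then x ∈ T. -/
variable {U : Type*}

theorem stmt_2 (R : Set (U × U)) (S choice tabu : Set U)
    (hd : S ∩ plus R S = ∅)
    (hc : choice ⊆ Set.univ \ (S ∪ plus R S ∪ minus R S))
    (ht : tabu = Set.univ \ (S ∪ plus R S ∪ choice))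
    (x : U) (hx : x ∈ choice)
    (hy : ∃ y ∈ tabu, minus R {y} ∩ choice = {x})
    (T : Set U) (hT : IsStable R T) (hST : S ⊆ T) (hTc : T \ S ⊆ choice) :
    x ∈ T := by
  obtain ⟨y, hyt, hyx⟩ := hy
  have hy' : y ∉ S ∪ plus R S ∪ choice := by
    rw [ht] at hyt
    exact hyt.2
  have hyT : y ∉ T := fun h =>
    hy' <| (em (y ∈ S)).elim (fun hS => Or.inl (Or.inl hS)) fun hS => Or.inr (hTc ⟨h, hS⟩)
  have hyp : y ∈ plus R T := by
    rw [show plus R T = Set.univ \ T from hT]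
    exact ⟨trivial, hyT⟩
  obtain ⟨z, hzT, hzy⟩ := hyp
  have hzS : z ∉ S := fun h => hy' (Or.inl (Or.inr ⟨z, h, hzy⟩))
  have hzx : z ∈ minus R {y} ∩ choice := ⟨⟨y, rfl, hzy⟩, hTc ⟨hzT, hzS⟩⟩
  rw [hyx] at hzx
  exact hzx ▸ hzT
end

section
/- Let H=(A,R) be an abstract argumentation framework, S ⊆ A with S ∩ S⁺ = ∅, choice ⊆ A \ (S ∪ S⁺ ∪ S⁻), tabu = A \ (S ∪ S⁺ ∪ choice), and let x ∈ tabu be an argument with {x}⁻ ⊆ S⁺ ∪ tabu. Then there does not exist a stable extension T ⊇ S such that T \ S ⊆ choice. -/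
variable {U : Type*}

theorem stmt_3 (R : Set (U × U)) (S choice tabu : Set U)
    (hd : S ∩ plus R S = ∅)
    (hc : choice ⊆ Set.univ \ (S ∪ plus R S ∪ minus R S))
    (ht : tabu = Set.univ \ (S ∪ plus R S ∪ choice))
    (x : U) (hx : x ∈ tabu) (hxatt : minus R {x} ⊆ plus R S ∪ tabu) :
    ¬ ∃ T : Set U, IsStable R T ∧ S ⊆ T ∧ T \ S ⊆ choice := by
  rintro ⟨T, hT, hST, hTc⟩
  subst ht
  obtain ⟨-, hx⟩ := hx
  have hxT : x ∉ T := fun h => by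
    by_cases hxS : x ∈ S
    · exact hx (.inl (.inl hxS))
    · exact hx (.inr (hTc ⟨h, hxS⟩))
  have hxp : x ∈ plus R T := hT ▸ ⟨trivial, hxT⟩
  obtain ⟨y, hyT, hyx⟩ := hxp
  rcases hxatt ⟨x, rfl, hyx⟩ with ⟨z, hzS, hzy⟩ | ⟨-, hy⟩
  · have hyp : y ∈ plus R T := ⟨z, hST hzS, hzy⟩
    rw [hT] at hyp
    exact hyp.2 hyT
  · by_cases hyS : y ∈ S
    · exact hy (.inl (.inl hyS))
    · exact hy (.inr (hTc ⟨hyT, hyS⟩))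
end

section
/- Let H=(A,R) be an abstract argumentation framework, S ⊆ A with S ∩ S⁺ = ∅, choice ⊆ A \ (S ∪ S⁺ ∪ S⁻), tabu = A \ (S ∪ S⁺ ∪ choice), μ a labelling of H with respect to S, and v an argument with μ(v)=blank such that for all y ∈ {v}⁻ it holds that μ(y) ∈ {out, must-out}. If there is a stable extension T ⊇ {x | μ(x)=in} such that T \ {x | μ(x)=in} ⊆ {x | μ(x)=blank}, then v ∈ T. -/
variable {U : Type*}

/-- The four labels. -/
inductive Label | blank | inn | out | mustOut

/-- `μ` is a labelling with respect to `S` (and the associated `choice`, `tabu`). -/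
def IsLabelling (R : Set (U × U)) (S choice tabu : Set U) (μ : U → Label) : Prop :=
  ∀ x, (x ∈ S ↔ μ x = Label.inn) ∧ (x ∈ plus R S ↔ μ x = Label.out) ∧
       (x ∈ choice ↔ μ x = Label.blank) ∧ (x ∈ tabu ↔ μ x = Label.mustOut)

theorem stmt_5 (R : Set (U × U)) (S choice tabu : Set U)
    (hd : S ∩ plus R S = ∅)
    (hc : choice ⊆ Set.univ \ (S ∪ plus R S ∪ minus R S))
    (ht : tabu = Set.univ \ (S ∪ plus R S ∪ choice))
    (μ : U → Label) (hμ : IsLabelling R S choice tabu μ)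
    (v : U) (hv : μ v = Label.blank)
    (hvatt : ∀ y ∈ minus R {v}, μ y = Label.out ∨ μ y = Label.mustOut)
    (T : Set U) (hT : IsStable R T)
    (hST : {x | μ x = Label.inn} ⊆ T)
    (hTc : T \ {x | μ x = Label.inn} ⊆ {x | μ x = Label.blank}) :
    v ∈ T := by
  by_contra hvT
  have hvplus : v ∈ plus R T := by
    rw [IsStable] at hT
    exact hT ▸ ⟨Set.mem_univ v, hvT⟩
  obtain ⟨y, hyT, hyv⟩ := hvplus
  have hy := hvatt y ⟨v, rfl, hyv⟩
  by_cases hin : μ y = Label.inn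
  · simp [hin] at hy
  · have hblank : μ y = Label.blank := hTc ⟨hyT, hin⟩
    simp [hblank] at hy
end

section
/- Let H=(A,R) be an abstract argumentation framework, S ⊆ A with S ∩ S⁺ = ∅, choice ⊆ A \ (S ∪ S⁺ ∪ S⁻), tabu = A \ (S ∪ S⁺ ∪ choice), μ a labelling of H with respect to S, and v an argument with μ(v)=blank such that for some y with μ(y)=must-out it is the case that {x ∈ {y}⁻ | μ(x)=blank} = {v}. If there is a stable extension T ⊇ {x | μ(x)=in} such that T \ {x | μ(x)=in} ⊆ {x | μ(x)=blank}, then v ∈ T. -/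
variable {U : Type*}

theorem stmt_6 (R : Set (U × U)) (S choice tabu : Set U)
    (hd : S ∩ plus R S = ∅)
    (hc : choice ⊆ Set.univ \ (S ∪ plus R S ∪ minus R S))
    (ht : tabu = Set.univ \ (S ∪ plus R S ∪ choice))
    (μ : U → Label) (hμ : IsLabelling R S choice tabu μ)
    (v : U) (hv : μ v = Label.blank)
    (hy : ∃ y, μ y = Label.mustOut ∧ {x | x ∈ minus R {y} ∧ μ x = Label.blank} = {v})
    (T : Set U) (hT : IsStable R T)
    (hST : {x | μ x = Label.inn} ⊆ T)
    (hTc : T \ {x | μ x = Label.inn} ⊆ {x | μ x = Label.blank}) :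
    v ∈ T := by
  obtain ⟨y, hy, hyv⟩ := hy
  have hyT : y ∉ T := fun h => by
    have hblank : μ y = Label.blank := hTc ⟨h, fun hin : μ y = Label.inn => by simp [hy] at hin⟩
    simp [hy] at hblank
  obtain ⟨x, hxT, hxy⟩ : y ∈ plus R T := hT ▸ ⟨Set.mem_univ y, hyT⟩
  have hx : μ x ≠ Label.inn := fun hin => by
    have hout := (hμ y).2.1.1 ⟨x, (hμ x).1.2 hin, hxy⟩
    simp [hy] at hout
  have hxv : x ∈ ({v} : Set U) := hyv ▸ ⟨⟨y, rfl, hxy⟩, hTc ⟨hxT, hx⟩⟩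
  exact Set.mem_singleton_iff.1 hxv ▸ hxT
end

section
/- Let H=(A,R) be an abstract argumentation framework, S ⊆ A with S ∩ S⁺ = ∅, choice ⊆ A \ (S ∪ S⁺ ∪ S⁻), tabu = A \ (S ∪ S⁺ ∪ choice), μ a labelling of H with respect to S, and x an argument with μ(x)=must-out such that for all y ∈ {x}⁻ it is the case that μ(y) ∈ {out, must-out}. Then there does not exist a stable extension Q ⊇ {v | μ(v)=in} such that Q \ {v | μ(v)=in} ⊆ {v | μ(v)=blank}. -/
variable {U : Type*}

theorem stmt_7 (R : Set (U × U)) (S choice tabu : Set U)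
    (hd : S ∩ plus R S = ∅)
    (hc : choice ⊆ Set.univ \ (S ∪ plus R S ∪ minus R S))
    (ht : tabu = Set.univ \ (S ∪ plus R S ∪ choice))
    (μ : U → Label) (hμ : IsLabelling R S choice tabu μ)
    (x : U) (hx : μ x = Label.mustOut)
    (hxatt : ∀ y ∈ minus R {x}, μ y = Label.out ∨ μ y = Label.mustOut) :
    ¬ ∃ Q : Set U, IsStable R Q ∧ {v | μ v = Label.inn} ⊆ Q ∧
      Q \ {v | μ v = Label.inn} ⊆ {v | μ v = Label.blank} := by
  rintro ⟨Q, hQ, -, hsub⟩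
  have label_of_mem : ∀ y ∈ Q, μ y = Label.inn ∨ μ y = Label.blank := fun y hy =>
    or_iff_not_imp_left.mpr fun hin => hsub ⟨hy, hin⟩
  have hxQ : x ∉ Q := fun h => by
    rcases label_of_mem x h with h | h <;> simp [hx] at h
  obtain ⟨y, hy, hyx⟩ : x ∈ plus R Q := by
    rw [hQ]
    exact ⟨trivial, hxQ⟩
  rcases label_of_mem y hy with h | h <;>
    rcases hxatt y ⟨x, rfl, hyx⟩ with h' | h' <;> simp [h] at h'
end

section
/- Let H=(A,R) be an abstract argumentation framework and S, choice, tabu, δ ⊆ A with S ⊆ A, choice ⊆ A \ (S ∪ S⁺ ∪ S⁻), tabu = A \ (S ∪ S⁺ ∪ choice), δ ⊆ choice, and δ ∩ δ⁻ = ∅. Then (tabu ∪ δ⁻) \ (S⁺ ∪ δ⁺) = A \ ((S ∪ δ) ∪ (S ∪ δ)⁺ ∪ (choice \ (δ ∪ δ⁺ ∪ δ⁻))). -/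
variable {U : Type*}

theorem stmt_15 (R : Set (U × U)) (S choice tabu δ : Set U)
    (hc : choice ⊆ Set.univ \ (S ∪ plus R S ∪ minus R S))
    (ht : tabu = Set.univ \ (S ∪ plus R S ∪ choice))
    (hδ : δ ⊆ choice) (hδm : δ ∩ minus R δ = ∅) :
    (tabu ∪ minus R δ) \ (plus R S ∪ plus R δ) =
      Set.univ \ ((S ∪ δ) ∪ plus R (S ∪ δ) ∪ (choice \ (δ ∪ plus R δ ∪ minus R δ))) := by
  have h_plus : plus R (S ∪ δ) = plus R S ∪ plus R δ := by
    ext y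
    simp only [plus, Set.mem_union, Set.mem_ofPred_eq, or_and_right, exists_or]
  have h_attack : ∀ x ∈ minus R δ, x ∉ S := by
    rintro x ⟨d, hd, hxd⟩ hxS
    exact (hc (hδ hd)).2 (Or.inl (Or.inr ⟨x, hxS, hxd⟩))
  have h_disj : ∀ x ∈ δ, x ∉ minus R δ := fun x hx hm =>
    Set.notMem_empty x (hδm ▸ ⟨hx, hm⟩)
  rw [h_plus, ht]
  ext x
  have h₁ := h_attack x
  have h₂ := h_disj x
  have h₃ := @hδ x
  simp only [Set.mem_sdiff, Set.mem_union, Set.mem_univ, true_and]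
  tauto
end
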